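/- There exists a metaplectic section: a family φ = (φ_γ)_{γ ∈ SL₂(ℤ)} assigning to each γ ∈ SL₂(ℤ) a holomorphic function φ_γ on ℍ⁺ such that φ_γ(z)² = cz + d whenever γ has bottom row (c,d), and φ_α(β·z)·φ_β(z) = A(α,β)·φ_{αβ}(z) for all α, β ∈ SL₂(ℤ) and all z ∈ ℍ⁺. -/

import Mathlib

open Matrix

noncomputable section

abbrev GL2Z := GL (Fin 2) ℤ

/-- The Hilbert symbol at the infinite place of `ℚ`:
`(a,b) = -1` if `a < 0` and `b < 0`, and `(a,b) = 1` otherwise. -/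
def hilb (a b : ℚ) : ℤˣ := if a < 0 ∧ b < 0 then -1 else 1

/-- Kubota's function `χ`: for `γ = [[a,b],[c,d]]`, `χ(γ) = c` if `c ≠ 0`, else `χ(γ) = d`. -/
def chi (γ : GL2Z) : ℤ :=
  if (γ : Matrix (Fin 2) (Fin 2) ℤ) 1 0 = 0 then (γ : Matrix (Fin 2) (Fin 2) ℤ) 1 1
  else (γ : Matrix (Fin 2) (Fin 2) ℤ) 1 0

/-- The determinant of an element of `GL₂(ℤ)`, as an integer. -/
def detZ (γ : GL2Z) : ℤ := ((γ : Matrix (Fin 2) (Fin 2) ℤ)).det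

/-- Kubota's twisted 2-cocycle
`A(α,β) = (det α, det β)·(χ(αβ)/χ(α), χ(αβ)/(χ(β)·det α))`. -/
def KA (α β : GL2Z) : ℤˣ :=
  hilb (detZ α) (detZ β) *
    hilb ((chi (α * β) : ℚ) / (chi α : ℚ))
      ((chi (α * β) : ℚ) / ((chi β : ℚ) * (detZ α : ℚ)))

/-- The matrix `R = [[-1,0],[0,1]]` as an element of `GL₂(ℤ)`. -/
def Rm : GL2Z :=
  ⟨!![-1, 0; 0, 1], !![-1, 0; 0, 1],
    by rw [Matrix.mul_fin_two, Matrix.one_fin_two]; norm_num,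
    by rw [Matrix.mul_fin_two, Matrix.one_fin_two]; norm_num⟩

/-- `B(γ) = (χ(γ), χ(γR))`. -/
def KB (γ : GL2Z) : ℤˣ := hilb (chi γ) (chi (γ * Rm))

/-- The upper half-plane `ℍ⁺` as a subset of `ℂ`. -/
def Hplus : Set ℂ := {z : ℂ | 0 < z.im}

/-- The double half-plane `ℍ* = ℍ⁺ ∪ ℍ⁻` as a subset of `ℂ`. -/
def Hstar : Set ℂ := {z : ℂ | z.im ≠ 0}

/-- The Möbius action `γ·z = (az+b)/(cz+d)` of `GL₂(ℤ)` on the double half-plane. -/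
def mact (γ : GL2Z) (z : ℂ) : ℂ :=
  (((γ : Matrix (Fin 2) (Fin 2) ℤ) 0 0 : ℂ) * z + ((γ : Matrix (Fin 2) (Fin 2) ℤ) 0 1 : ℂ)) /
    (((γ : Matrix (Fin 2) (Fin 2) ℤ) 1 0 : ℂ) * z + ((γ : Matrix (Fin 2) (Fin 2) ℤ) 1 1 : ℂ))

/-- `φ` is a metaplectic section: a family `(φ_γ)_{γ ∈ SL₂(ℤ)}` of holomorphic functions
on `ℍ⁺` with `φ_γ(z)² = cz + d` whenever `γ` has bottom row `(c,d)`, and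
`φ_α(β·z)·φ_β(z) = A(α,β)·φ_{αβ}(z)` for all `α, β ∈ SL₂(ℤ)` and `z ∈ ℍ⁺`. -/
def IsMetaplecticSection (φ : GL2Z → ℂ → ℂ) : Prop :=
  (∀ γ : GL2Z, detZ γ = 1 → DifferentiableOn ℂ (φ γ) Hplus) ∧
  (∀ γ : GL2Z, detZ γ = 1 → ∀ z ∈ Hplus,
    (φ γ z) ^ 2 = ((γ : Matrix (Fin 2) (Fin 2) ℤ) 1 0 : ℂ) * z +
      ((γ : Matrix (Fin 2) (Fin 2) ℤ) 1 1 : ℂ)) ∧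
  (∀ α β : GL2Z, detZ α = 1 → detZ β = 1 → ∀ z ∈ Hplus,
    φ α (mact β z) * φ β z = ((KA α β : ℤ) : ℂ) * φ (α * β) z)

/-- The automorphy factor of the weight-`w/2` slash action of `G̃` on functions on the
double half-plane (`w` is twice the weight), relative to a metaplectic section `φ`. -/
def slashFactor (w : ℤ) (φ : GL2Z → ℂ → ℂ) (γ : GL2Z) (ε : ℤˣ) (z : ℂ) : ℂ :=
  if 0 < z.im then
    if detZ γ = 1 then (((ε : ℤ) : ℂ) * φ γ z) ^ (-w)
    else (Complex.I * ((ε : ℤ) : ℂ) * ((KA Rm γ : ℤ) : ℂ) * φ (Rm * γ) z) ^ (-w)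
  else
    if detZ γ = 1 then (((ε : ℤ) : ℂ) * ((KB γ : ℤ) : ℂ) * φ (Rm * γ * Rm) (-z)) ^ (-w)
    else (Complex.I * ((ε : ℤ) : ℂ) * ((KA Rm γ : ℤ) : ℂ) * ((KB (Rm * γ) : ℤ) : ℂ) *
      φ (γ * Rm) (-z)) ^ (-w)

/-- The weight-`w/2` slash action `f ↦ f|[γ,ε]` of `G̃` on functions on the double
half-plane. -/
def slash (w : ℤ) (φ : GL2Z → ℂ → ℂ) (f : ℂ → ℂ) (γ : GL2Z) (ε : ℤˣ) : ℂ → ℂ :=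
  fun z => f (mact γ z) * slashFactor w φ γ ε z

/-- The automorphy factor `j(γ,z) = cz + d`. -/
def autFactor (γ : GL2Z) (z : ℂ) : ℂ :=
  ((γ : Matrix (Fin 2) (Fin 2) ℤ) 1 0 : ℂ) * z + ((γ : Matrix (Fin 2) (Fin 2) ℤ) 1 1 : ℂ)

/-- The square root of `cz + d` with argument in `[-π/2, π/2)`. -/
def metaplecticRoot (γ : GL2Z) (z : ℂ) : ℂ :=
  if 0 < chi γ then autFactor γ z ^ (1 / 2 : ℂ)
  else -Complex.I * (-autFactor γ z) ^ (1 / 2 : ℂ)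

lemma chi_ne_zero {γ : GL2Z} (h : detZ γ = 1) : chi γ ≠ 0 := by
  rw [detZ, Matrix.det_fin_two] at h
  unfold chi
  split_ifs with h0
  · intro h1
    simp [h0, h1] at h
  · exact h0

lemma detZ_mul (α β : GL2Z) : detZ (α * β) = detZ α * detZ β := by
  simp [detZ]

lemma autFactor_im (γ : GL2Z) (z : ℂ) :
    (autFactor γ z).im = (γ : Matrix (Fin 2) (Fin 2) ℤ) 1 0 * z.im := by
  simp [autFactor]

/-- If `χ(γ) > 0`, then `cz + d` has argument in `[0, π)`. -/
lemma autFactor_of_chi_pos {γ : GL2Z} (h : 0 < chi γ) {z : ℂ} (hz : z ∈ Hplus) :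
    autFactor γ z ∈ Complex.slitPlane ∧ 0 ≤ (autFactor γ z).im := by
  have hz : 0 < z.im := hz
  unfold chi at h
  rw [autFactor_im, Complex.mem_slitPlane_iff, autFactor_im]
  split_ifs at h with h0
  · simp [h0, autFactor, h]
  · have : (0 : ℝ) < (γ : Matrix (Fin 2) (Fin 2) ℤ) 1 0 := by exact_mod_cast h
    have := mul_pos this hz
    exact ⟨Or.inr this.ne', this.le⟩

/-- If `χ(γ) < 0`, then `-(cz + d)` has argument in `[0, π)`. -/
lemma neg_autFactor_of_chi_neg {γ : GL2Z} (h : chi γ < 0) {z : ℂ} (hz : z ∈ Hplus) :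
    -autFactor γ z ∈ Complex.slitPlane ∧ 0 ≤ (-autFactor γ z).im := by
  have hz : 0 < z.im := hz
  unfold chi at h
  rw [Complex.mem_slitPlane_iff, Complex.neg_im, autFactor_im]
  split_ifs at h with h0
  · simp [h0, autFactor, h]
  · have : ((γ : Matrix (Fin 2) (Fin 2) ℤ) 1 0 : ℝ) < 0 := by exact_mod_cast h
    have := mul_neg_of_neg_of_pos this hz
    exact ⟨Or.inr (by linarith), by linarith⟩

lemma autFactor_ne_zero {γ : GL2Z} (h : detZ γ = 1) {z : ℂ} (hz : z ∈ Hplus) :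
    autFactor γ z ≠ 0 := by
  rcases (chi_ne_zero h).lt_or_gt with h | h
  · exact neg_ne_zero.1 (Complex.slitPlane_ne_zero (neg_autFactor_of_chi_neg h hz).1)
  · exact Complex.slitPlane_ne_zero (autFactor_of_chi_pos h hz).1

lemma mact_mem_Hplus {β : GL2Z} (h : detZ β = 1) {z : ℂ} (hz : z ∈ Hplus) :
    mact β z ∈ Hplus := by
  have hj := autFactor_ne_zero h hz
  have hz : 0 < z.im := hz
  rw [detZ, Matrix.det_fin_two] at h
  have hR : ((β : Matrix (Fin 2) (Fin 2) ℤ) 0 0 * (β : Matrix (Fin 2) (Fin 2) ℤ) 1 1 -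
    (β : Matrix (Fin 2) (Fin 2) ℤ) 0 1 * (β : Matrix (Fin 2) (Fin 2) ℤ) 1 0 : ℝ) = 1 := by
    exact_mod_cast h
  have him : (mact β z).im = z.im / Complex.normSq (autFactor β z) := by
    change (_ / autFactor β z).im = _
    rw [Complex.div_im, ← sub_div]
    congr 1
    simp only [autFactor, Complex.add_re, Complex.add_im, Complex.mul_re, Complex.mul_im,
      Complex.intCast_re, Complex.intCast_im]
    linear_combination z.im * hR
  change 0 < (mact β z).im
  rw [him]
  exact div_pos hz (Complex.normSq_pos.2 hj)

lemma autFactor_mul (α : GL2Z) {β : GL2Z} {z : ℂ} (hj : autFactor β z ≠ 0) :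
    autFactor α (mact β z) * autFactor β z = autFactor (α * β) z := by
  have hm : mact β z * autFactor β z = ((β : Matrix (Fin 2) (Fin 2) ℤ) 0 0 : ℂ) * z +
      ((β : Matrix (Fin 2) (Fin 2) ℤ) 0 1 : ℂ) := div_mul_cancel₀ _ hj
  have h : autFactor α (mact β z) * autFactor β z =
      ((α : Matrix (Fin 2) (Fin 2) ℤ) 1 0 : ℂ) * (mact β z * autFactor β z) +
      ((α : Matrix (Fin 2) (Fin 2) ℤ) 1 1 : ℂ) * autFactor β z := by
    rw [autFactor]; ring
  rw [h, hm]
  simp only [autFactor, Units.val_mul, Matrix.mul_apply, Fin.sum_univ_two]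
  push_cast
  ring

lemma cpow_half_sq (w : ℂ) : (w ^ (1 / 2 : ℂ)) ^ 2 = w := by
  simp

lemma metaplecticRoot_sq (γ : GL2Z) (z : ℂ) : metaplecticRoot γ z ^ 2 = autFactor γ z := by
  unfold metaplecticRoot
  split_ifs
  · exact cpow_half_sq _
  · rw [mul_pow, cpow_half_sq, neg_sq, Complex.I_sq]
    ring

lemma metaplecticRoot_differentiableOn {γ : GL2Z} (h : detZ γ = 1) :
    DifferentiableOn ℂ (metaplecticRoot γ) Hplus := by
  have hd : DifferentiableOn ℂ (autFactor γ) Hplus := by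
    unfold autFactor
    fun_prop
  unfold metaplecticRoot
  split_ifs with h0
  · exact hd.cpow_const fun z hz => (autFactor_of_chi_pos h0 hz).1
  · have h1 : chi γ < 0 := lt_of_le_of_ne (not_lt.1 h0) (chi_ne_zero h)
    exact (hd.neg.cpow_const fun z hz => (neg_autFactor_of_chi_neg h1 hz).1).const_mul _

/-- The half-open first quadrant `0 ≤ arg q < π/2`. -/
def firstQuadrant : Set ℂ := {q | 0 < q.re ∧ 0 ≤ q.im}

lemma cpow_half_mem_firstQuadrant {w : ℂ} (h : w ∈ Complex.slitPlane) (hi : 0 ≤ w.im) :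
    w ^ (1 / 2 : ℂ) ∈ firstQuadrant := by
  have harg : 0 ≤ w.arg := Complex.arg_nonneg_iff.2 hi
  have hpi : w.arg < Real.pi :=
    lt_of_le_of_ne (Complex.arg_le_pi w) (Complex.mem_slitPlane_iff_arg.1 h).1
  have hlog : (Complex.log w * (1 / 2 : ℂ)).im = w.arg / 2 := by
    have : (1 / 2 : ℂ) = ((1 / 2 : ℝ) : ℂ) := by push_cast; rfl
    rw [this, Complex.im_mul_ofReal, Complex.log_im]
    ring
  rw [Complex.cpow_def_of_ne_zero (Complex.slitPlane_ne_zero h)]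
  refine ⟨?_, ?_⟩
  · rw [Complex.exp_re, hlog]
    exact mul_pos (Real.exp_pos _) (Real.cos_pos_of_mem_Ioo ⟨by linarith, by linarith⟩)
  · rw [Complex.exp_im, hlog]
    exact mul_nonneg (Real.exp_pos _).le
      (Real.sin_nonneg_of_nonneg_of_le_pi (by linarith) (by linarith))

lemma mul_ne_neg_of_mem_firstQuadrant {p q r : ℂ} (hp : p ∈ firstQuadrant)
    (hq : q ∈ firstQuadrant) (hr : r ∈ firstQuadrant) : p * q ≠ -r := by
  obtain ⟨hp1, hp2⟩ := hp
  obtain ⟨hq1, hq2⟩ := hq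
  obtain ⟨hr1, hr2⟩ := hr
  intro h
  have hre := congrArg Complex.re h
  have him := congrArg Complex.im h
  simp only [Complex.mul_re, Complex.mul_im, Complex.neg_re, Complex.neg_im] at hre him
  have h1 : p.re * q.im = 0 := by nlinarith [mul_nonneg hp1.le hq2, mul_nonneg hp2 hq1.le]
  have h2 : q.im = 0 := (mul_eq_zero.1 h1).resolve_left hp1.ne'
  rw [h2] at hre
  nlinarith [mul_pos hp1 hq1]

lemma mul_ne_neg_I_mul_of_mem_firstQuadrant {p q r : ℂ} (hp : p ∈ firstQuadrant)
    (hq : q ∈ firstQuadrant) (hr : r ∈ firstQuadrant) : p * q ≠ -Complex.I * r := by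
  obtain ⟨hp1, hp2⟩ := hp
  obtain ⟨hq1, hq2⟩ := hq
  intro h
  have him := congrArg Complex.im h
  simp at him
  nlinarith [mul_nonneg hp1.le hq2, mul_nonneg hp2 hq1.le, hr.1]

/-- The sign of `χ(γ)` determines the quadrant of `metaplecticRoot γ z`. -/
lemma metaplecticRoot_cases {γ : GL2Z} (h : detZ γ = 1) {z : ℂ} (hz : z ∈ Hplus) :
    (0 < chi γ ∧ ∃ q ∈ firstQuadrant, metaplecticRoot γ z = q) ∨
      (chi γ < 0 ∧ ∃ q ∈ firstQuadrant, metaplecticRoot γ z = -Complex.I * q) := by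
  rcases (chi_ne_zero h).lt_or_gt with h0 | h0
  · obtain ⟨h1, h2⟩ := neg_autFactor_of_chi_neg h0 hz
    exact Or.inr ⟨h0, _, cpow_half_mem_firstQuadrant h1 h2, if_neg h0.not_gt⟩
  · obtain ⟨h1, h2⟩ := autFactor_of_chi_pos h0 hz
    exact Or.inl ⟨h0, _, cpow_half_mem_firstQuadrant h1 h2, if_pos h0⟩

lemma KA_of_detZ_eq_one {α β : GL2Z} (hα : detZ α = 1) (hβ : detZ β = 1) :
    KA α β = if ((chi (α * β) : ℚ) / chi α < 0 ∧ (chi (α * β) : ℚ) / chi β < 0) then -1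
      else 1 := by
  simp [KA, hilb, hα, hβ, (zero_le_one (α := ℚ)).not_gt]

lemma metaplecticRoot_mul {α β : GL2Z} (hα : detZ α = 1) (hβ : detZ β = 1) {z : ℂ}
    (hz : z ∈ Hplus) :
    metaplecticRoot α (mact β z) * metaplecticRoot β z =
      ((KA α β : ℤ) : ℂ) * metaplecticRoot (α * β) z := by
  have hsq : (metaplecticRoot α (mact β z) * metaplecticRoot β z) ^ 2 =
      metaplecticRoot (α * β) z ^ 2 := by
    rw [mul_pow, metaplecticRoot_sq, metaplecticRoot_sq, metaplecticRoot_sq,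
      autFactor_mul α (autFactor_ne_zero hβ hz)]
  have hI := Complex.I_mul_I
  rw [KA_of_detZ_eq_one hα hβ]
  rcases metaplecticRoot_cases hα (mact_mem_Hplus hβ hz) with ⟨ha, p, hp, ep⟩ | ⟨ha, p, hp, ep⟩ <;>
  rcases metaplecticRoot_cases hβ hz with ⟨hb, q, hq, eq⟩ | ⟨hb, q, hq, eq⟩ <;>
  rcases metaplecticRoot_cases (γ := α * β) (by rw [detZ_mul, hα, hβ, one_mul]) hz with
    ⟨hc, r, hr, er⟩ | ⟨hc, r, hr, er⟩ <;>
  rw [ep, eq, er] at hsq ⊢ <;>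
  have h1 := mul_ne_neg_of_mem_firstQuadrant hp hq hr <;>
  have h2 := mul_ne_neg_I_mul_of_mem_firstQuadrant hp hq hr <;>
  simp only [div_neg_iff, Int.cast_pos, Int.cast_lt_zero, ha, hb, hc, ha.not_gt, hb.not_gt,
    hc.not_gt, and_true, and_false, and_self, or_false, or_true, or_self, if_true, if_false,
    Units.val_neg, Units.val_one, Int.cast_neg, Int.cast_one] <;>
  rcases sq_eq_sq_iff_eq_or_eq_neg.1 hsq with h | h <;>
  first
  | linear_combination h
  | exact absurd (by linear_combination h) h1
  | exact absurd (by linear_combination -h + p * q * hI) h1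
  | exact absurd (by linear_combination Complex.I * h + (p * q + r) * hI) h1
  | exact absurd (by linear_combination h) h2
  | exact absurd (by linear_combination -h + p * q * hI) h2
  | exact absurd (by linear_combination Complex.I * h + p * q * hI) h2

/-- There exists a metaplectic section: a family `(φ_γ)_{γ ∈ SL₂(ℤ)}` of holomorphic
functions on `ℍ⁺` with `φ_γ(z)² = cz + d` for `γ` with bottom row `(c,d)`, and
`φ_α(β·z)·φ_β(z) = A(α,β)·φ_{αβ}(z)`. -/
theorem exists_metaplectic_section : ∃ φ : GL2Z → ℂ → ℂ, IsMetaplecticSection φ := by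
  exact ⟨metaplecticRoot, fun _ h => metaplecticRoot_differentiableOn h,
    fun γ _ z _ => metaplecticRoot_sq γ z, fun _ _ hα hβ _ hz => metaplecticRoot_mul hα hβ hz⟩
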